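/- arXiv:math/0603670 — 2 statements merged into one kernel-verified Lean document; each statement's English description precedes it below -/
import Mathlib

section
/- Let (W,S) be a Coxeter system of finite rank, w ∈ W, and α a root. Then exactly one of the following holds: (1) α is w-periodic; (2) α is not w-periodic and the set {m ∈ ℤ : α separates w^m and w^{m+1}} is finite of even cardinality; (3) α is not w-periodic and the set {m ∈ ℤ : α separates w^m and w^{m+1}} is finite of odd cardinality. -/
namespace CoxeterPaper

/-- The entry `-cos (π / m i j)` of the matrix of the standard bilinear form,
interpreted as `-1` when `m i j = ∞` (encoded as `0`). -/
noncomputable def formEntry {B : Type*} (M : CoxeterMatrix B) (i j : B) : ℝ :=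
  if M i j = 0 then -1 else - Real.cos (Real.pi / (M i j : ℝ))

/-- The standard bilinear form associated to a Coxeter matrix, on `V = B → ℝ`
(with basis `{α_s : s ∈ S}` identified with the standard basis). -/
noncomputable def bilin {B : Type*} [Fintype B] (M : CoxeterMatrix B) (v w : B → ℝ) : ℝ :=
  ∑ i, ∑ j, v i * w j * formEntry M i j

/-- The standard bilinear form is positive definite. -/
def IsPosDef {B : Type*} [Fintype B] (M : CoxeterMatrix B) : Prop :=
  ∀ v : B → ℝ, v ≠ 0 → 0 < bilin M v v

/-- The standard bilinear form is positive semidefinite. -/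
def IsPosSemidef {B : Type*} [Fintype B] (M : CoxeterMatrix B) : Prop :=
  ∀ v : B → ℝ, 0 ≤ bilin M v v

/-- The Coxeter graph: vertices are the elements of `B`, and `i ≠ j` are adjacent
iff `m i j ≥ 3` (including `m i j = ∞`, encoded as `0`), i.e. iff `m i j ≠ 2`. -/
def coxeterGraph {B : Type*} (M : CoxeterMatrix B) : SimpleGraph B :=
  SimpleGraph.fromRel fun i j => M i j ≠ 2

/-- A Coxeter matrix (system) is irreducible if its Coxeter graph is connected. -/
def IsIrreducible {B : Type*} (M : CoxeterMatrix B) : Prop := (coxeterGraph M).Connected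

/-- The simple root `α_i`, as the `i`-th standard basis vector of `V = B → ℝ`. -/
noncomputable def simpleRoot {B : Type*} [DecidableEq B] (i : B) : B → ℝ := Pi.single i 1

/-- The reflection `σ_i : λ ↦ λ - 2 (α_i, λ) α_i` of the canonical geometric
representation of a Coxeter system. -/
noncomputable def reflMap {B : Type*} [Fintype B] [DecidableEq B] (M : CoxeterMatrix B) (i : B) :
    Module.End ℝ (B → ℝ) :=
  LinearMap.id -
    (2 : ℝ) • (∑ j : B, formEntry M i j • (LinearMap.proj j : (B → ℝ) →ₗ[ℝ] ℝ)).smulRight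
      (simpleRoot i)

/-- `ρ` is the canonical geometric representation `σ : W → GL(V)` of the Coxeter
system `cs`: the homomorphism sending each simple reflection `s_i` to `σ_i`
(such a homomorphism is unique, since the `s_i` generate `W`). -/
def IsGeometricRep {B W : Type*} [Fintype B] [DecidableEq B] [Group W] {M : CoxeterMatrix B}
    (cs : CoxeterSystem M W) (ρ : W →* Module.End ℝ (B → ℝ)) : Prop :=
  ∀ i : B, ρ (cs.simple i) = reflMap M i

/-- `v` is a root: an element of `Φ = {w(α_i) : w ∈ W, i ∈ B}`. -/
def IsRoot {B W : Type*} [DecidableEq B] [Group W] (ρ : W →* Module.End ℝ (B → ℝ))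
    (v : B → ℝ) : Prop :=
  ∃ (w : W) (i : B), v = ρ w (simpleRoot i)

/-- All coordinates of `v` in the basis of simple roots are `≥ 0`. -/
def IsPositiveVec {B : Type*} (v : B → ℝ) : Prop := ∀ i, 0 ≤ v i

/-- All coordinates of `v` in the basis of simple roots are `≤ 0`. -/
def IsNegativeVec {B : Type*} (v : B → ℝ) : Prop := ∀ i, v i ≤ 0

/-- The root `α` separates `u` and `v`: `uα` and `vα` have opposite signs. -/
def Separates {B W : Type*} [Group W] (ρ : W →* Module.End ℝ (B → ℝ)) (u v : W)
    (α : B → ℝ) : Prop :=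
  (IsPositiveVec (ρ u α) ∧ IsNegativeVec (ρ v α)) ∨
    (IsNegativeVec (ρ u α) ∧ IsPositiveVec (ρ v α))

/-- The root `α` is `w`-periodic: `w^m α = α` for some positive integer `m`. -/
def IsPeriodic {B W : Type*} [Group W] (ρ : W →* Module.End ℝ (B → ℝ)) (w : W)
    (α : B → ℝ) : Prop :=
  ∃ m : ℕ, 0 < m ∧ ρ (w ^ m) α = α

/-- The set `{m ∈ ℤ : α separates w^m and w^(m+1)}`. -/
def sepSet {B W : Type*} [Group W] (ρ : W →* Module.End ℝ (B → ℝ)) (w : W)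
    (α : B → ℝ) : Set ℤ :=
  {m : ℤ | Separates ρ (w ^ m) (w ^ (m + 1)) α}

/-- The root `α` is `w`-even: not `w`-periodic, and
`{m ∈ ℤ : α separates w^m and w^(m+1)}` is finite of even cardinality. -/
def IsWEven {B W : Type*} [Group W] (ρ : W →* Module.End ℝ (B → ℝ)) (w : W)
    (α : B → ℝ) : Prop :=
  ¬ IsPeriodic ρ w α ∧ (sepSet ρ w α).Finite ∧ Even (sepSet ρ w α).ncard

/-- The root `α` is `w`-odd: not `w`-periodic, and
`{m ∈ ℤ : α separates w^m and w^(m+1)}` is finite of odd cardinality. -/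
def IsWOdd {B W : Type*} [Group W] (ρ : W →* Module.End ℝ (B → ℝ)) (w : W)
    (α : B → ℝ) : Prop :=
  ¬ IsPeriodic ρ w α ∧ (sepSet ρ w α).Finite ∧ Odd (sepSet ρ w α).ncard

section Form

variable {B : Type*} (M : CoxeterMatrix B)

theorem formEntry_comm (i j : B) : formEntry M i j = formEntry M j i := by
  simp [formEntry, M.symmetric i j]

theorem formEntry_self (i : B) : formEntry M i i = 1 := by
  simp [formEntry]

variable [Fintype B]

theorem bilin_comm (v w : B → ℝ) : bilin M v w = bilin M w v := by
  simp only [bilin]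
  rw [Finset.sum_comm]
  refine Finset.sum_congr rfl fun i _ => Finset.sum_congr rfl fun j _ => ?_
  rw [formEntry_comm]
  ring

variable [DecidableEq B]

theorem reflMap_apply (i : B) (v : B → ℝ) :
    reflMap M i v = v - (2 * ∑ j, formEntry M i j * v j) • simpleRoot i := by
  simp [reflMap, LinearMap.sum_apply, mul_smul]

theorem reflMap_simpleRoot (i j : B) :
    reflMap M i (simpleRoot j) = simpleRoot j - (2 * formEntry M i j) • simpleRoot i := by
  simp [reflMap_apply, simpleRoot, Pi.single_apply]

theorem reflMap_simpleRoot_self (i : B) : reflMap M i (simpleRoot i) = -simpleRoot i := by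
  rw [reflMap_simpleRoot, formEntry_self]
  module

theorem reflMap_apply_of_ne {i j : B} (h : j ≠ i) (v : B → ℝ) : reflMap M i v j = v j := by
  simp [reflMap_apply, simpleRoot, h]

theorem bilin_smul_simpleRoot (c : ℝ) (i : B) :
    bilin M (c • simpleRoot i) (c • simpleRoot i) = c ^ 2 := by
  simp [bilin, simpleRoot, Pi.single_apply, formEntry_self, sq]

theorem bilin_eq_toBilin' (v w : B → ℝ) :
    bilin M v w = Matrix.toBilin' (Matrix.of (formEntry M)) v w := by
  simp only [bilin, Matrix.toBilin'_apply, Matrix.of_apply]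
  exact Finset.sum_congr rfl fun _ _ => Finset.sum_congr rfl fun _ _ => by ring

theorem bilin_simpleRoot_left (i : B) (v : B → ℝ) :
    bilin M (simpleRoot i) v = ∑ j, formEntry M i j * v j := by
  simp [bilin, simpleRoot, Pi.single_apply, mul_comm]

theorem bilin_reflMap (i : B) (v : B → ℝ) :
    bilin M (reflMap M i v) (reflMap M i v) = bilin M v v := by
  have hc := bilin_comm M v (simpleRoot i)
  have h1 : bilin M (simpleRoot i) (simpleRoot i) = 1 := by
    simpa using bilin_smul_simpleRoot M 1 i
  rw [reflMap_apply, ← bilin_simpleRoot_left]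
  generalize hb : bilin M (simpleRoot i) v = b at hc ⊢
  rw [bilin_eq_toBilin'] at hc h1 hb ⊢
  simp only [map_sub, map_smul, LinearMap.sub_apply, LinearMap.smul_apply, smul_eq_mul, hc, h1, hb,
    bilin_eq_toBilin']
  ring

end Form

/-- The Chebyshev-type coefficients describing the orbit of a simple root under the dihedral group
of order `2 * m` (infinite if `m = 0`). -/
noncomputable def dihedralCoeff (m k : ℕ) : ℝ :=
  if m = 0 then k else Real.sin (k * (Real.pi / m)) / Real.sin (Real.pi / m)

theorem sin_pi_div_pos {m : ℕ} (hm : 2 ≤ m) : 0 < Real.sin (Real.pi / m) := by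
  have hm' : (2 : ℝ) ≤ m := by exact_mod_cast hm
  apply Real.sin_pos_of_pos_of_lt_pi
  · positivity
  · exact div_lt_self Real.pi_pos (by linarith)

theorem dihedralCoeff_zero (m : ℕ) : dihedralCoeff m 0 = 0 := by
  simp [dihedralCoeff]

theorem dihedralCoeff_one {m : ℕ} (hm : m ≠ 1) : dihedralCoeff m 1 = 1 := by
  unfold dihedralCoeff
  split_ifs with h
  · simp
  · simpa using div_self (sin_pi_div_pos (by lia : 2 ≤ m)).ne'

theorem dihedralCoeff_nonneg {m k : ℕ} (hm : m ≠ 1) (hk : m ≠ 0 → k ≤ m) :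
    0 ≤ dihedralCoeff m k := by
  unfold dihedralCoeff
  split_ifs with h
  · positivity
  · refine div_nonneg (Real.sin_nonneg_of_nonneg_of_le_pi (by positivity) ?_)
      (sin_pi_div_pos (by lia : 2 ≤ m)).le
    have hm0 : (0 : ℝ) < m := by positivity
    have hk' : (k : ℝ) ≤ m := by exact_mod_cast hk h
    calc (k : ℝ) * (Real.pi / m) ≤ m * (Real.pi / m) := by gcongr
      _ = Real.pi := by field_simp

theorem dihedralCoeff_add_two {B : Type*} (M : CoxeterMatrix B) (i j : B) (k : ℕ) :
    dihedralCoeff (M i j) (k + 2) =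
      -(2 * formEntry M i j) * dihedralCoeff (M i j) (k + 1) - dihedralCoeff (M i j) k := by
  unfold dihedralCoeff formEntry
  split_ifs with h
  · push_cast
    ring
  · generalize Real.pi / (M i j : ℝ) = θ
    have h2 : Real.sin ((k + 2 : ℕ) * θ) =
        2 * Real.cos θ * Real.sin ((k + 1 : ℕ) * θ) - Real.sin (k * θ) := by
      have e1 : ((k + 2 : ℕ) : ℝ) * θ = (k + 1 : ℕ) * θ + θ := by push_cast; ring
      have e2 : (k : ℝ) * θ = (k + 1 : ℕ) * θ - θ := by push_cast; ring
      rw [e1, e2, Real.sin_add, Real.sin_sub]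
      ring
    rw [h2]
    ring

theorem isPositiveVec_simpleRoot {B : Type*} [DecidableEq B] (i : B) :
    IsPositiveVec (simpleRoot i) := by
  intro j
  by_cases h : j = i <;> simp [simpleRoot, h]

theorem IsPositiveVec.neg {B : Type*} {v : B → ℝ} (h : IsPositiveVec v) : IsNegativeVec (-v) :=
  fun i => by simpa using h i

theorem IsNegativeVec.neg {B : Type*} {v : B → ℝ} (h : IsNegativeVec v) : IsPositiveVec (-v) :=
  fun i => by simpa using h i

theorem map_mul_apply {R V W : Type*} [Semiring R] [AddCommMonoid V] [Module R V] [Group W]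
    (ρ : W →* Module.End R V) (u v : W) (x : V) : ρ (u * v) x = ρ u (ρ v x) := by
  rw [map_mul, Module.End.mul_apply]

theorem injective_map {R V W : Type*} [Semiring R] [AddCommMonoid V] [Module R V] [Group W]
    (ρ : W →* Module.End R V) (u : W) : Function.Injective (ρ u) := by
  refine Function.LeftInverse.injective (g := ρ u⁻¹) fun x => ?_
  rw [← map_mul_apply, inv_mul_cancel, map_one, Module.End.one_apply]

theorem IsRoot.map {B W : Type*} [DecidableEq B] [Group W] {ρ : W →* Module.End ℝ (B → ℝ)}
    {v : B → ℝ} (h : IsRoot ρ v) (u : W) : IsRoot ρ (ρ u v) := by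
  obtain ⟨w, i, rfl⟩ := h
  exact ⟨u * w, i, (map_mul_apply ρ u w _).symm⟩

theorem injective_zpow_map {B W : Type*} [Group W] {ρ : W →* Module.End ℝ (B → ℝ)} {w : W}
    {α : B → ℝ} (h : ¬ IsPeriodic ρ w α) :
    Function.Injective fun m : ℤ => ρ (w ^ m) α := by
  intro a b heq
  wlog hab : a < b generalizing a b
  · by_contra hne
    exact hne (this heq.symm (by lia)).symm
  refine absurd ⟨(b - a).toNat, by lia, ?_⟩ h
  apply injective_map ρ (w ^ a)
  rw [← map_mul_apply, ← zpow_natCast, ← zpow_add, Int.toNat_of_nonneg (by lia),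
    add_sub_cancel]
  exact heq.symm

section Rep

open CoxeterSystem

/-- A maximal factorization of `w` through a rank two standard parabolic subgroup. -/
theorem exists_mul_alternatingWord {B W : Type*} [Group W] {M : CoxeterMatrix B}
    (cs : CoxeterSystem M W) {w : W} {s t : B}
    (hs : cs.length (w * cs.simple s) = cs.length w + 1)
    (ht : cs.length (w * cs.simple t) + 1 = cs.length w) :
    ∃ (v : W) (k : ℕ), w = v * cs.wordProd (alternatingWord s t k) ∧
      cs.length v + k = cs.length w ∧ 0 < k ∧ (M s t ≠ 0 → k + 1 ≤ M s t) ∧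
      cs.length (v * cs.simple s) = cs.length v + 1 ∧
      cs.length (v * cs.simple t) = cs.length v + 1 := by
  classical
  let P : ℕ → Prop := fun k => ∃ v : W, w = v * cs.wordProd (alternatingWord s t k) ∧
    cs.length v + k = cs.length w
  have hP1 : P 1 := ⟨w * cs.simple t, by simp [alternatingWord, wordProd], ht⟩
  have hPle : ∀ k, P k → k ≤ cs.length w := fun k ⟨v, _, h⟩ => by lia
  have hlen : 1 ≤ cs.length w := by lia
  have hk1 : 1 ≤ Nat.findGreatest P (cs.length w) := Nat.le_findGreatest hlen hP1
  obtain ⟨v, hw, hv⟩ : P (Nat.findGreatest P (cs.length w)) := Nat.findGreatest_spec hlen hP1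
  have hmax : ∀ k, P k → k ≤ Nat.findGreatest P (cs.length w) :=
    fun k hk => Nat.le_findGreatest (hPle k hk) hk
  generalize Nat.findGreatest P (cs.length w) = k at hk1 hw hv hmax
  have hsucc : cs.length (v * cs.simple (if Even k then t else s)) = cs.length v + 1 := by
    refine (cs.length_mul_simple v _).resolve_right fun h => ?_
    have hP : P (k + 1) := by
      refine ⟨v * cs.simple (if Even k then t else s), ?_, by lia⟩
      rw [alternatingWord_succ', wordProd_cons, mul_assoc, cs.simple_mul_simple_cancel_left, hw]
    exact absurd (hmax _ hP) (by lia)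
  have hpred : cs.length (v * cs.simple (if Even k then s else t)) = cs.length v + 1 := by
    refine (cs.length_mul_simple v _).resolve_right fun h => ?_
    obtain ⟨j, rfl⟩ : ∃ j, k = j + 1 := ⟨k - 1, by lia⟩
    have hite : (if Even (j + 1) then s else t) = if Even j then t else s := by
      by_cases hj : Even j <;> simp [hj, Nat.even_add_one]
    rw [hite] at h
    rw [alternatingWord_succ', wordProd_cons, ← mul_assoc] at hw
    have h1 := cs.length_mul_le (v * cs.simple (if Even j then t else s))
      (cs.wordProd (alternatingWord s t j))
    have h2 := cs.length_wordProd_le (alternatingWord s t j)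
    rw [← hw] at h1
    rw [length_alternatingWord] at h2
    lia
  refine ⟨v, k, hw, hv, hk1, fun hM => ?_, ?_, ?_⟩
  · by_contra! hlt
    refine cs.not_isReduced_alternatingWord t s (m := k + 1) (by rwa [M.symmetric])
      (by rwa [M.symmetric]) ?_
    have h1 := cs.length_mul_le v (cs.wordProd (alternatingWord t s (k + 1)))
    have h2 := cs.length_wordProd_le (alternatingWord t s (k + 1))
    have h3 : v * cs.wordProd (alternatingWord t s (k + 1)) = w * cs.simple s := by
      rw [alternatingWord_succ, wordProd_concat, ← mul_assoc, ← hw]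
    rw [h3] at h1
    rw [length_alternatingWord] at h2
    rw [CoxeterSystem.IsReduced, length_alternatingWord]
    lia
  · split_ifs at hsucc hpred <;> assumption
  · split_ifs at hsucc hpred <;> assumption

variable {B W : Type*} [Fintype B] [DecidableEq B] [Group W] {M : CoxeterMatrix B}
  {cs : CoxeterSystem M W} {ρ : W →* Module.End ℝ (B → ℝ)}

theorem IsGeometricRep.map_simple_self (hρ : IsGeometricRep cs ρ) (i : B) :
    ρ (cs.simple i) (simpleRoot i) = -simpleRoot i := by
  rw [hρ, reflMap_simpleRoot_self]

theorem IsGeometricRep.map_mul_simple (hρ : IsGeometricRep cs ρ) (w : W) (i : B) :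
    ρ (w * cs.simple i) (simpleRoot i) = -ρ w (simpleRoot i) := by
  rw [map_mul_apply, hρ.map_simple_self, map_neg]

theorem IsRoot.neg (hρ : IsGeometricRep cs ρ) {v : B → ℝ} (h : IsRoot ρ v) : IsRoot ρ (-v) := by
  obtain ⟨w, i, rfl⟩ := h
  exact ⟨w * cs.simple i, i, (hρ.map_mul_simple w i).symm⟩

theorem IsGeometricRep.bilin_map (hρ : IsGeometricRep cs ρ) (w : W) (v : B → ℝ) :
    bilin M (ρ w v) (ρ w v) = bilin M v v := by
  induction w using cs.simple_induction_left with
  | one => simp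
  | mul_simple_left w i ih => rw [map_mul_apply, hρ, bilin_reflMap, ih]

theorem IsRoot.bilin_self (hρ : IsGeometricRep cs ρ) {v : B → ℝ} (h : IsRoot ρ v) :
    bilin M v v = 1 := by
  obtain ⟨w, i, rfl⟩ := h
  rw [hρ.bilin_map]
  simpa using bilin_smul_simpleRoot M 1 i

theorem IsRoot.ne_zero (hρ : IsGeometricRep cs ρ) {v : B → ℝ} (h : IsRoot ρ v) : v ≠ 0 := by
  rintro rfl
  simpa [bilin] using h.bilin_self hρ

/-- The orbit of a simple root under a rank two standard parabolic subgroup. -/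
theorem IsGeometricRep.map_alternatingWord (hρ : IsGeometricRep cs ρ) {s t : B} (hst : s ≠ t)
    (k : ℕ) :
    ρ (cs.wordProd (alternatingWord s t k)) (simpleRoot s) =
      if Even k then
        dihedralCoeff (M s t) (k + 1) • simpleRoot s + dihedralCoeff (M s t) k • simpleRoot t
      else
        dihedralCoeff (M s t) k • simpleRoot s + dihedralCoeff (M s t) (k + 1) • simpleRoot t := by
  induction k with
  | zero =>
    simp [alternatingWord, dihedralCoeff_zero, dihedralCoeff_one (M.off_diagonal s t hst)]
  | succ k ih =>
    rw [alternatingWord_succ', wordProd_cons, map_mul_apply, ih, dihedralCoeff_add_two, hρ]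
    by_cases hk : Even k
    · have hk' : ¬ Even (k + 1) := by simpa [Nat.even_add_one] using hk
      simp only [hk, hk', if_true, if_false, map_add, map_smul, reflMap_simpleRoot,
        formEntry_self, formEntry_comm M t s]
      module
    · have hk' : Even (k + 1) := by simpa [Nat.even_add_one] using hk
      simp only [hk, hk', if_true, if_false, map_add, map_smul, reflMap_simpleRoot,
        formEntry_self]
      module

/-- If `ℓ(w s) > ℓ(w)` then `w` sends the simple root of `s` to a positive root. -/
theorem IsGeometricRep.isPositiveVec_map (hρ : IsGeometricRep cs ρ) (w : W) (s : B)
    (hs : cs.length (w * cs.simple s) = cs.length w + 1) :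
    IsPositiveVec (ρ w (simpleRoot s)) := by
  induction hn : cs.length w using Nat.strong_induction_on generalizing w s with
  | _ n ih =>
    by_cases hw : w = 1
    · simpa [hw] using isPositiveVec_simpleRoot s
    · obtain ⟨t, ht⟩ := cs.exists_rightDescent_of_ne_one hw
      rw [cs.isRightDescent_iff] at ht
      have hst : s ≠ t := by
        rintro rfl
        lia
      obtain ⟨v, k, hwv, hlen, hk, hkM, hvs, hvt⟩ := exists_mul_alternatingWord cs hs ht
      have hps := ih _ (by lia) v s hvs rfl
      have hpt := ih _ (by lia) v t hvt rfl
      have hM := M.off_diagonal s t hst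
      have h0 := dihedralCoeff_nonneg (k := k) hM fun h => (Nat.le_succ k).trans (hkM h)
      have h1 := dihedralCoeff_nonneg hM hkM
      rw [hwv, map_mul_apply, hρ.map_alternatingWord hst]
      intro i
      have hsi := hps i
      have hti := hpt i
      split_ifs <;> simp only [map_add, map_smul, Pi.add_apply, Pi.smul_apply, smul_eq_mul] <;>
        positivity

/-- Every root is positive or negative. -/
theorem IsRoot.isPositiveVec_or_isNegativeVec (hρ : IsGeometricRep cs ρ) {v : B → ℝ}
    (h : IsRoot ρ v) : IsPositiveVec v ∨ IsNegativeVec v := by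
  obtain ⟨w, i, rfl⟩ := h
  rcases cs.length_mul_simple w i with hi | hi
  · exact Or.inl (hρ.isPositiveVec_map w i hi)
  · right
    have := hρ.isPositiveVec_map (w * cs.simple i) i
      (by rw [cs.simple_mul_simple_cancel_right, hi])
    rw [hρ.map_mul_simple] at this
    simpa using this.neg

/-- A simple reflection makes only its own simple root change sign. -/
theorem IsRoot.eq_simpleRoot (hρ : IsGeometricRep cs ρ) {v : B → ℝ} (h : IsRoot ρ v)
    (hv : IsPositiveVec v) {i : B} (hi : IsNegativeVec (ρ (cs.simple i) v)) :
    v = simpleRoot i := by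
  have hvi : v = v i • simpleRoot i := by
    ext j
    by_cases hj : j = i
    · simp [hj, simpleRoot]
    · have := hi j
      rw [hρ, reflMap_apply_of_ne M hj] at this
      simpa [simpleRoot, hj] using le_antisymm this (hv j)
  have hsq := h.bilin_self hρ
  rw [hvi, bilin_smul_simpleRoot] at hsq
  have h1 : v i = 1 := by nlinarith [hv i]
  rw [hvi, h1, one_smul]

/-- Only finitely many positive roots are made negative by a given element. -/
theorem IsGeometricRep.finite_inversions (hρ : IsGeometricRep cs ρ) (w : W) :
    {v | IsRoot ρ v ∧ IsPositiveVec v ∧ IsNegativeVec (ρ w v)}.Finite := by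
  induction w using cs.simple_induction_right with
  | one =>
    refine Set.finite_empty.subset fun v ⟨hr, hp, hn⟩ => hr.ne_zero hρ ?_
    rw [map_one] at hn
    exact funext fun i => le_antisymm (hn i) (hp i)
  | mul_simple_right w i ih =>
    refine ((ih.image (ρ (cs.simple i))).insert (simpleRoot i)).subset fun v ⟨hr, hp, hn⟩ => ?_
    rcases (hr.map (cs.simple i)).isPositiveVec_or_isNegativeVec hρ with h | h
    · refine Or.inr ⟨ρ (cs.simple i) v, ⟨hr.map _, h, by rwa [← map_mul_apply]⟩, ?_⟩
      rw [← map_mul_apply, cs.simple_mul_simple_self, map_one, Module.End.one_apply]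
    · exact Or.inl (hr.eq_simpleRoot hρ hp h)

theorem IsGeometricRep.finite_sepSet (hρ : IsGeometricRep cs ρ) {w : W} {α : B → ℝ}
    (hα : IsRoot ρ α) (h : ¬ IsPeriodic ρ w α) : (sepSet ρ w α).Finite := by
  have hfin := hρ.finite_inversions w
  refine ((hfin.union (hfin.image Neg.neg)).preimage (injective_zpow_map h).injOn).subset ?_
  intro m hm
  have hw : ρ (w ^ (m + 1)) α = ρ w (ρ (w ^ m) α) := by
    rw [← map_mul_apply, ← zpow_one_add, add_comm]
  have hr : IsRoot ρ (ρ (w ^ m) α) := hα.map _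
  rcases hm with ⟨hp, hn⟩ | ⟨hn, hp⟩
  · exact Or.inl ⟨hr, hp, hw ▸ hn⟩
  · refine Or.inr ⟨-ρ (w ^ m) α, ⟨hr.neg hρ, hn.neg, ?_⟩, neg_neg _⟩
    rw [map_neg, ← hw]
    exact hp.neg

end Rep

/-- For `w ∈ W` and a root `α`, exactly one of the following
holds: `α` is `w`-periodic; `α` is `w`-even; `α` is `w`-odd. -/
theorem periodic_even_odd_trichotomy
    {B W : Type*} [Fintype B] [DecidableEq B] [Group W] {M : CoxeterMatrix B}
    (cs : CoxeterSystem M W) (ρ : W →* Module.End ℝ (B → ℝ)) (hρ : IsGeometricRep cs ρ)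
    (w : W) (α : B → ℝ) (hα : IsRoot ρ α) :
    (IsPeriodic ρ w α ∧ ¬ IsWEven ρ w α ∧ ¬ IsWOdd ρ w α) ∨
    (¬ IsPeriodic ρ w α ∧ IsWEven ρ w α ∧ ¬ IsWOdd ρ w α) ∨
    (¬ IsPeriodic ρ w α ∧ ¬ IsWEven ρ w α ∧ IsWOdd ρ w α) := by
  by_cases h : IsPeriodic ρ w α
  · exact Or.inl ⟨h, fun h' => h'.1 h, fun h' => h'.1 h⟩
  · have hfin := hρ.finite_sepSet hα h
    rcases Nat.even_or_odd (sepSet ρ w α).ncard with he | ho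
    · exact Or.inr (Or.inl ⟨h, ⟨h, hfin, he⟩, fun h' => Nat.not_even_iff_odd.2 h'.2.2 he⟩)
    · exact Or.inr (Or.inr ⟨h, fun h' => Nat.not_even_iff_odd.2 ho h'.2.2, h, hfin, ho⟩)

end CoxeterPaper
end

section
/- Let (W,S) be a Coxeter system of finite rank with S = {s_1, s_2, …, s_n}. Then the Coxeter element c = s_n ⋯ s_2 s_1 is an essential element of W, i.e., c does not lie in any proper parabolic subgroup of W. -/
namespace CoxeterPaper

/-- A parabolic subgroup of `W` is a subgroup of the form `x W_I x⁻¹` with `x ∈ W`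
and `I ⊆ S`, where `W_I` is the (special) subgroup generated by `{s_i : i ∈ I}`. -/
def IsParabolic {B W : Type*} [Group W] {M : CoxeterMatrix B} (cs : CoxeterSystem M W)
    (P : Subgroup W) : Prop :=
  ∃ (x : W) (I : Set B),
    P = Subgroup.map (MulAut.conj x).toMonoidHom (Subgroup.closure (cs.simple '' I))

/-- An element of `W` is essential if it lies in no proper parabolic subgroup. -/
def IsEssential {B W : Type*} [Group W] {M : CoxeterMatrix B} (cs : CoxeterSystem M W)
    (w : W) : Prop :=
  ∀ P : Subgroup W, IsParabolic cs P → P ≠ ⊤ → w ∉ P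

open Module Polynomial.Chebyshev in
/-- If both off-diagonal pairings of two reflections are `-2 cos (π / m)` with `2 ≤ m`, then the
order of the product of the two reflections divides `m`. -/
theorem reflection_mul_reflection_pow_eq_one {V : Type*} [AddCommGroup V] [Module ℝ V]
    {x y : V} {f g : Dual ℝ V} (hf : f x = 2) (hg : g y = 2) {m : ℕ} (hm : 2 ≤ m)
    (hfy : f y = -2 * Real.cos (Real.pi / m)) (hgx : g x = -2 * Real.cos (Real.pi / m)) :
    (reflection hf * reflection hg) ^ m = 1 := by
  ext z
  rw [reflection_mul_reflection_pow_apply hf hg m z, LinearEquiv.coe_one, id_eq]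
  rcases hm.eq_or_lt with rfl | hm
  · have hfy₀ : f y = 0 := by simp [hfy]
    have hgx₀ : g x = 0 := by simp [hgx]
    norm_num [hfy₀, hgx₀]
    module
  · set θ : ℝ := 2 * Real.pi / m with hθ
    have hm₀ : (0 : ℝ) < m := by positivity
    have hmθ : m * θ = 2 * Real.pi := by rw [hθ]; field_simp
    have ht : f y * g x - 2 = 2 * Real.cos θ := by
      have : θ = 2 * (Real.pi / m) := by rw [hθ]; ring
      rw [hfy, hgx, this, Real.cos_two_mul]
      ring
    have hsin : Real.sin θ ≠ 0 := by
      refine (Real.sin_pos_of_pos_of_lt_pi (by positivity) ?_).ne'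
      rw [hθ, div_lt_iff₀ hm₀]
      have : (2 : ℝ) < m := by exact_mod_cast hm
      nlinarith [Real.pi_pos]
    rw [ht]
    rcases m.even_or_odd' with ⟨k, hk | hk⟩
    · have hS : (S ℝ (k - 1)).eval (2 * Real.cos θ) = 0 := by
        apply (mul_eq_zero_iff_right hsin).mp
        rw [S_two_mul_real_cos]
        have : ((k - 1 : ℤ) + 1 : ℝ) * θ = Real.pi := by
          rw [hk] at hmθ
          push_cast at hmθ ⊢
          linarith
        rw [this, Real.sin_pi]
      have h₁ : ((m : ℤ) - 2) / 2 = k - 1 := by omega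
      have h₂ : ((m : ℤ) - 1) / 2 = k - 1 := by omega
      simp [h₁, h₂, hS]
    · have hS : (S ℝ k).eval (2 * Real.cos θ) + (S ℝ (k - 1)).eval (2 * Real.cos θ) = 0 := by
        apply (mul_eq_zero_iff_right hsin).mp
        rw [add_mul, S_two_mul_real_cos, S_two_mul_real_cos]
        have : ((k : ℤ) + 1 : ℝ) * θ = 2 * Real.pi - ((k - 1 : ℤ) + 1 : ℝ) * θ := by
          rw [hk] at hmθ
          push_cast at hmθ ⊢
          linarith
        rw [this, Real.sin_two_pi_sub, neg_add_cancel]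
      have h₁ : ((m : ℤ) - 1) / 2 = k := by omega
      have h₂ : ((m : ℤ) - 3) / 2 = k - 1 := by omega
      have h₃ : (m : ℤ) / 2 = k := by omega
      have h₄ : ((m : ℤ) - 2) / 2 = k - 1 := by omega
      simp [h₁, h₂, h₃, h₄, hS]

section Realization

variable {B W : Type*} [Group W] (M : CoxeterMatrix B)

/-- A real vector space carrying a representation of the Coxeter group of `M` for which both the
simple roots and the simple coroots are linearly independent. -/
abbrev Realization (_ : CoxeterMatrix B) : Type _ := (B →₀ ℝ) × (B → ℝ)

/-- The simple coroots: the standard basis vectors of the first summand. -/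
noncomputable def coroot (i : B) : Realization M := (Finsupp.single i 1, 0)

/-- The simple roots: linear forms on the realization which pair with the coroots through the
matrix `-2 cos (π / M i j)`. -/
noncomputable def root (i : B) : Module.Dual ℝ (Realization M) :=
  (Finsupp.linearCombination ℝ fun j ↦ -2 * Real.cos (Real.pi / M i j)).coprod
    (LinearMap.proj i)

theorem root_apply_coroot (i j : B) :
    root M i (coroot M j) = -2 * Real.cos (Real.pi / M i j) := by
  simp [root, coroot]

theorem root_apply_coroot_self (i : B) : root M i (coroot M i) = 2 := by
  simp [root_apply_coroot]

theorem root_apply_snd (i : B) (y : B → ℝ) : root M i (0, y) = y i := by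
  simp [root]

/-- The simple reflections of the realization. -/
noncomputable def simpleReflection (i : B) : Realization M ≃ₗ[ℝ] Realization M :=
  Module.reflection (root_apply_coroot_self M i)

theorem simpleReflection_apply (i : B) (v : Realization M) :
    simpleReflection M i v = v - root M i v • coroot M i :=
  Module.reflection_apply v _

theorem isLiftable_simpleReflection : M.IsLiftable (simpleReflection M) := by
  intro i j
  rcases eq_or_ne i j with rfl | hij
  · ext1 v
    simpa [simpleReflection] using Module.involutive_reflection (root_apply_coroot_self M i) v
  · rcases Nat.eq_zero_or_pos (M i j) with h₀ | h₀
    · rw [h₀, pow_zero]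
    · have h₁ := M.off_diagonal i j hij
      exact reflection_mul_reflection_pow_eq_one _ _ (by omega) (root_apply_coroot M i j)
        (by rw [root_apply_coroot, M.symmetric])

variable {M} (cs : CoxeterSystem M W)

/-- The representation of a Coxeter group on its realization. -/
noncomputable def realizationHom : W →* (Realization M ≃ₗ[ℝ] Realization M) :=
  cs.lift ⟨simpleReflection M, isLiftable_simpleReflection M⟩

theorem realizationHom_simple_apply (i : B) (v : Realization M) :
    realizationHom cs (cs.simple i) v = v - root M i v • coroot M i := by
  rw [realizationHom, cs.lift_apply_simple, simpleReflection_apply]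

theorem realizationHom_simple_apply_eq_self_iff (i : B) (v : Realization M) :
    realizationHom cs (cs.simple i) v = v ↔ root M i v = 0 := by
  rw [realizationHom_simple_apply, sub_eq_self]
  refine ⟨fun h ↦ ?_, fun h ↦ by rw [h, zero_smul]⟩
  simpa [root_apply_coroot_self] using congrArg (root M i) h

theorem realizationHom_wordProd_fst_of_notMem {ω : List B} {j : B} (hj : j ∉ ω)
    (v : Realization M) : (realizationHom cs (cs.wordProd ω) v).1 j = v.1 j := by
  induction ω with
  | nil => simp
  | cons i ω ih =>
    rw [List.mem_cons, not_or] at hj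
    rw [cs.wordProd_cons, map_mul, LinearEquiv.mul_apply, realizationHom_simple_apply]
    simp [coroot, hj.1, ih hj.2]

theorem root_eq_zero_of_realizationHom_wordProd_apply_eq_self {ω : List B} (hω : ω.Nodup)
    {v : Realization M} (hv : realizationHom cs (cs.wordProd ω) v = v) {i : B} (hi : i ∈ ω) :
    root M i v = 0 := by
  induction ω with
  | nil => simp at hi
  | cons j ω ih =>
    rw [List.nodup_cons] at hω
    rw [cs.wordProd_cons, map_mul, LinearEquiv.mul_apply] at hv
    have hu := realizationHom_wordProd_fst_of_notMem cs hω.1 v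
    set u := realizationHom cs (cs.wordProd ω) v
    have hju : root M j u = 0 := by
      have h := congrArg (fun w : Realization M ↦ w.1 j) hv
      simpa [realizationHom_simple_apply, coroot, hu] using h
    rw [(realizationHom_simple_apply_eq_self_iff cs j u).mpr hju] at hv
    rcases List.mem_cons.mp hi with rfl | hi
    · rwa [← hv]
    · exact ih hω.2 hv hi

theorem realizationHom_apply_eq_self_of_mem_closure {I : Set B} {v : Realization M}
    (hv : ∀ i ∈ I, root M i v = 0) {w : W} (hw : w ∈ Subgroup.closure (cs.simple '' I)) :
    realizationHom cs w v = v := by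
  suffices h : Subgroup.closure (cs.simple '' I) ≤
      (MulAction.stabilizer (Realization M ≃ₗ[ℝ] Realization M) v).comap (realizationHom cs) from
    h hw
  rw [Subgroup.closure_le]
  rintro _ ⟨i, hi, rfl⟩
  exact (realizationHom_simple_apply_eq_self_iff cs i v).mpr (hv i hi)

/-- The product of a word containing every simple generator exactly once is essential. -/
theorem isEssential_wordProd {ω : List B} (hω : ω.Nodup) (hmem : ∀ i, i ∈ ω) :
    IsEssential cs (cs.wordProd ω) := by
  classical
  rintro _ ⟨x, I, rfl⟩ hP ⟨w, hw, hxw : x * w * x⁻¹ = _⟩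
  obtain ⟨s, hs⟩ : ∃ s, s ∉ I := by
    by_contra! hI
    apply hP
    rw [Set.eq_univ_of_forall hI, Set.image_univ, cs.subgroup_closure_range_simple]
    exact Subgroup.map_top_of_surjective _ (MulAut.conj x).surjective
  let v : Realization M := (0, Pi.single s 1)
  have hwv : realizationHom cs w v = v :=
    realizationHom_apply_eq_self_of_mem_closure cs
      (fun i hi ↦ by
        rw [root_apply_snd, Pi.single_eq_of_ne (ne_of_mem_of_not_mem hi hs)]) hw
  have hfix : ∀ i, root M i (realizationHom cs x v) = 0 := fun i ↦ by
    refine root_eq_zero_of_realizationHom_wordProd_apply_eq_self cs hω ?_ (hmem i)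
    rw [← hxw, ← LinearEquiv.mul_apply, ← map_mul, inv_mul_cancel_right, map_mul,
      LinearEquiv.mul_apply, hwv]
  have hxv : v = realizationHom cs x v := by
    have h := realizationHom_apply_eq_self_of_mem_closure cs (I := Set.univ) (w := x⁻¹)
      (fun i _ ↦ hfix i) (by simp [cs.subgroup_closure_range_simple])
    rwa [← LinearEquiv.mul_apply, ← map_mul, inv_mul_cancel, map_one] at h
  have hsv := hfix s
  rw [← hxv, root_apply_snd, Pi.single_eq_same] at hsv
  exact one_ne_zero hsv

end Realization

/-- For a Coxeter system `(W, S)` with `S = {s_1, …, s_n}`, the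
Coxeter element `c = s_n ⋯ s_2 s_1` is essential: it lies in no proper parabolic
subgroup of `W`. -/
theorem coxeter_element_isEssential
    {n : ℕ} {W : Type*} [Group W] {M : CoxeterMatrix (Fin n)} (cs : CoxeterSystem M W) :
    IsEssential cs ((List.ofFn fun k : Fin n => cs.simple k).reverse.prod) := by
  have h := isEssential_wordProd cs
    (List.nodup_reverse.mpr (List.nodup_finRange n)) (by simp)
  rwa [CoxeterSystem.wordProd, List.map_reverse, ← List.ofFn_eq_map] at h

end CoxeterPaper
end
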